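/- Let F be a field with at least 4 elements and let l₀, l₁, l₂, l₃, l₄ ∈ F² be pairwise linearly independent vectors. Then the alternating sum Σ_{i=0}^{4} (−1)^i [cr₃(l₀, …, l̂_i, …, l₄)] (where l̂_i means l_i is omitted) equals 0 in the group 𝔭(F). -/

import Mathlib

open FreeAbelianGroup Matrix
open scoped Classical

/-- The set of five-term relators in the free abelian group on `F \ {0,1}`. -/
def fiveTermSet (F : Type*) [Field F] :
    Set (FreeAbelianGroup {x : F // x ≠ 0 ∧ x ≠ 1}) :=
  { z | ∃ (x y : F) (hx : x ≠ 0 ∧ x ≠ 1) (hy : y ≠ 0 ∧ y ≠ 1)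
      (_ : x ≠ y)
      (h1 : y / x ≠ 0 ∧ y / x ≠ 1)
      (h2 : (1 - x⁻¹) / (1 - y⁻¹) ≠ 0 ∧ (1 - x⁻¹) / (1 - y⁻¹) ≠ 1)
      (h3 : (1 - x) / (1 - y) ≠ 0 ∧ (1 - x) / (1 - y) ≠ 1),
      z = of (⟨x, hx⟩ : {x : F // x ≠ 0 ∧ x ≠ 1}) - of ⟨y, hy⟩ + of ⟨y / x, h1⟩
          - of ⟨(1 - x⁻¹) / (1 - y⁻¹), h2⟩ + of ⟨(1 - x) / (1 - y), h3⟩ }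

/-- The relators `[x] + [x⁻¹]`. -/
def invRelSet (F : Type*) [Field F] :
    Set (FreeAbelianGroup {x : F // x ≠ 0 ∧ x ≠ 1}) :=
  { z | ∃ (x : F) (hx : x ≠ 0 ∧ x ≠ 1) (hx' : x⁻¹ ≠ 0 ∧ x⁻¹ ≠ 1),
      z = of (⟨x, hx⟩ : {x : F // x ≠ 0 ∧ x ≠ 1}) + of ⟨x⁻¹, hx'⟩ }

/-- The relators `[x] + [1 - x]`. -/
def oneSubRelSet (F : Type*) [Field F] :
    Set (FreeAbelianGroup {x : F // x ≠ 0 ∧ x ≠ 1}) :=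
  { z | ∃ (x : F) (hx : x ≠ 0 ∧ x ≠ 1) (hx' : 1 - x ≠ 0 ∧ 1 - x ≠ 1),
      z = of (⟨x, hx⟩ : {x : F // x ≠ 0 ∧ x ≠ 1}) + of ⟨1 - x, hx'⟩ }

/-- The group `𝔭(F)`: the pre-Bloch group further divided by the relations
`[x] + [x⁻¹] = 0` and `[x] + [1-x] = 0`. -/
abbrev PGroup (F : Type*) [Field F] :=
  FreeAbelianGroup {x : F // x ≠ 0 ∧ x ≠ 1} ⧸
    AddSubgroup.closure (fiveTermSet F ∪ invRelSet F ∪ oneSubRelSet F)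

/-- The class `[x]` in `𝔭(F)` (junk value `0` for `x ∈ {0,1}`). -/
noncomputable def pgen {F : Type*} [Field F] (x : F) : PGroup F :=
  if h : x ≠ 0 ∧ x ≠ 1 then QuotientAddGroup.mk (of ⟨x, h⟩) else 0

/-- The 2×2 matrix with columns `u` and `w`. -/
def col2 {F : Type*} [Field F] (u w : Fin 2 → F) : Matrix (Fin 2) (Fin 2) F :=
  Matrix.of ![![u 0, w 0], ![u 1, w 1]]

/-- The cross-ratio of four vectors in `F²`. -/
def cr3 {F : Type*} [Field F] (v₀ v₁ v₂ v₃ : Fin 2 → F) : F :=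
  ((col2 v₀ v₃).det * (col2 v₁ v₂).det) / ((col2 v₀ v₂).det * (col2 v₁ v₃).det)

theorem det_col2 {F : Type*} [Field F] (u w : Fin 2 → F) :
    (col2 u w).det = u 0 * w 1 - w 0 * u 1 := by
  simp [col2, Matrix.det_fin_two]

theorem det_col2_ne_zero {F : Type*} [Field F] {u w : Fin 2 → F}
    (h : LinearIndependent F ![u, w]) : (col2 u w).det ≠ 0 := by
  have hcols : (col2 u w).col = ![u, w] := by
    funext j i
    fin_cases i <;> fin_cases j <;> rfl
  rw [← hcols, Matrix.linearIndependent_cols_iff_isUnit, Matrix.isUnit_iff_isUnit_det] at h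
  exact h.ne_zero

theorem cr3_ne_zero {F : Type*} [Field F] {v₀ v₁ v₂ v₃ : Fin 2 → F}
    (h₀₂ : (col2 v₀ v₂).det ≠ 0) (h₀₃ : (col2 v₀ v₃).det ≠ 0)
    (h₁₂ : (col2 v₁ v₂).det ≠ 0) (h₁₃ : (col2 v₁ v₃).det ≠ 0) :
    cr3 v₀ v₁ v₂ v₃ ≠ 0 :=
  div_ne_zero (mul_ne_zero h₀₃ h₁₂) (mul_ne_zero h₀₂ h₁₃)

/-- The Plücker relation, in terms of the cross-ratio. -/
theorem one_sub_cr3 {F : Type*} [Field F] {v₀ v₁ v₂ v₃ : Fin 2 → F}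
    (h₀₂ : (col2 v₀ v₂).det ≠ 0) (h₁₃ : (col2 v₁ v₃).det ≠ 0) :
    1 - cr3 v₀ v₁ v₂ v₃ =
      ((col2 v₀ v₁).det * (col2 v₂ v₃).det) / ((col2 v₀ v₂).det * (col2 v₁ v₃).det) := by
  rw [cr3, one_sub_div (mul_ne_zero h₀₂ h₁₃)]
  congr 1
  simp only [det_col2]
  ring

theorem cr3_ne_one {F : Type*} [Field F] {v₀ v₁ v₂ v₃ : Fin 2 → F}
    (h₀₁ : (col2 v₀ v₁).det ≠ 0) (h₀₂ : (col2 v₀ v₂).det ≠ 0)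
    (h₁₃ : (col2 v₁ v₃).det ≠ 0) (h₂₃ : (col2 v₂ v₃).det ≠ 0) :
    cr3 v₀ v₁ v₂ v₃ ≠ 1 := by
  intro h
  have key := one_sub_cr3 h₀₂ h₁₃
  rw [h, sub_self] at key
  exact div_ne_zero (mul_ne_zero h₀₁ h₂₃) (mul_ne_zero h₀₂ h₁₃) key.symm

theorem pgen_of_ne {F : Type*} [Field F] {x : F} (h : x ≠ 0 ∧ x ≠ 1) :
    pgen x = (QuotientAddGroup.mk (of ⟨x, h⟩) : PGroup F) :=
  dif_pos h

theorem pgen_five_term {F : Type*} [Field F] {x y z u w : F}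
    (hx : x ≠ 0 ∧ x ≠ 1) (hy : y ≠ 0 ∧ y ≠ 1) (hz : z ≠ 0 ∧ z ≠ 1)
    (hu : u ≠ 0 ∧ u ≠ 1) (hw : w ≠ 0 ∧ w ≠ 1)
    (ez : z = y / x) (eu : u = (1 - x⁻¹) / (1 - y⁻¹)) (ew : w = (1 - x) / (1 - y)) :
    pgen x - pgen y + pgen z - pgen u + pgen w = 0 := by
  subst ez eu ew
  have hxy : x ≠ y := by
    rintro rfl
    exact hz.2 (div_self hx.1)
  rw [pgen_of_ne hx, pgen_of_ne hy, pgen_of_ne hz, pgen_of_ne hu, pgen_of_ne hw]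
  exact (QuotientAddGroup.eq_zero_iff _).mpr <| AddSubgroup.subset_closure <|
    Or.inl <| Or.inl ⟨x, y, hx, hy, hxy, hz, hu, hw, rfl⟩

/-- For a field `F` with at least 4 elements and pairwise linearly independent
`l₀, …, l₄ ∈ F²`, the alternating sum `Σᵢ (-1)ⁱ [cr₃(l₀, …, l̂ᵢ, …, l₄)]` vanishes
in `𝔭(F)`. -/
theorem alternating_sum_cr3_eq_zero (F : Type*) [Field F]
    (h4 : ∃ a b c d : F, a ≠ b ∧ a ≠ c ∧ a ≠ d ∧ b ≠ c ∧ b ≠ d ∧ c ≠ d)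
    (l : Fin 5 → Fin 2 → F)
    (hl : ∀ i j, i ≠ j → LinearIndependent F ![l i, l j]) :
    ∑ i : Fin 5, (-1 : ℤ) ^ (i : ℕ) •
      pgen (cr3 (l (i.succAbove 0)) (l (i.succAbove 1))
        (l (i.succAbove 2)) (l (i.succAbove 3))) = 0 := by
  have hd : ∀ i j, i ≠ j → (col2 (l i) (l j)).det ≠ 0 :=
    fun i j hij => det_col2_ne_zero (hl i j hij)
  have h01 := hd 0 1 (by decide)
  have h02 := hd 0 2 (by decide)
  have h03 := hd 0 3 (by decide)
  have h04 := hd 0 4 (by decide)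
  have h12 := hd 1 2 (by decide)
  have h13 := hd 1 3 (by decide)
  have h14 := hd 1 4 (by decide)
  have h23 := hd 2 3 (by decide)
  have h24 := hd 2 4 (by decide)
  have h34 := hd 3 4 (by decide)
  have hx : cr3 (l 1) (l 2) (l 3) (l 4) ≠ 0 ∧ cr3 (l 1) (l 2) (l 3) (l 4) ≠ 1 :=
    ⟨cr3_ne_zero h13 h14 h23 h24, cr3_ne_one h12 h13 h24 h34⟩
  have hy : cr3 (l 0) (l 2) (l 3) (l 4) ≠ 0 ∧ cr3 (l 0) (l 2) (l 3) (l 4) ≠ 1 :=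
    ⟨cr3_ne_zero h03 h04 h23 h24, cr3_ne_one h02 h03 h24 h34⟩
  have ez : cr3 (l 0) (l 1) (l 3) (l 4) =
      cr3 (l 0) (l 2) (l 3) (l 4) / cr3 (l 1) (l 2) (l 3) (l 4) := by
    simp only [cr3]
    field_simp
  have ew : cr3 (l 0) (l 1) (l 2) (l 3) =
      (1 - cr3 (l 1) (l 2) (l 3) (l 4)) / (1 - cr3 (l 0) (l 2) (l 3) (l 4)) := by
    rw [one_sub_cr3 h13 h24, one_sub_cr3 h03 h24, cr3]
    field_simp
  have eu : cr3 (l 0) (l 1) (l 2) (l 4) =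
      (1 - (cr3 (l 1) (l 2) (l 3) (l 4))⁻¹) / (1 - (cr3 (l 0) (l 2) (l 3) (l 4))⁻¹) := by
    have hprod : cr3 (l 0) (l 1) (l 2) (l 4) =
        cr3 (l 0) (l 1) (l 2) (l 3) * cr3 (l 0) (l 1) (l 3) (l 4) := by
      simp only [cr3]
      field_simp
    have hinv : ∀ t : F, t ≠ 0 → 1 - t⁻¹ = -(1 - t) / t := fun t ht => by
      field_simp
      ring
    rw [hprod, ew, ez, hinv _ hx.1, hinv _ hy.1, div_div_div_eq, neg_mul, mul_neg,
      neg_div_neg_eq, mul_comm (cr3 (l 1) (l 2) (l 3) (l 4)), div_mul_div_comm]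
  have key := pgen_five_term hx hy
    ⟨cr3_ne_zero h03 h04 h13 h14, cr3_ne_one h01 h03 h14 h34⟩
    ⟨cr3_ne_zero h02 h04 h12 h14, cr3_ne_one h01 h02 h14 h24⟩
    ⟨cr3_ne_zero h02 h03 h12 h13, cr3_ne_one h01 h02 h13 h23⟩ ez eu ew
  rw [← key, Fin.sum_univ_five]
  simp [Fin.succAbove, Fin.lt_def, sub_eq_add_neg, pow_succ]
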